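/- Let α > 0 and 0 < β < 1/2 be real constants with α + H₂(β) < 1. Then there exists m₀ such that for every integer m ≥ m₀ and every natural number k with k ≤ α·m there exists a subspace G of the Pauli space V(Q) on the qubit set Q = Fin m × Fin m × Fin 2 (two qubits per site of an m×m lattice, n = 2m² qubits, with position map pos(i,j,t) = (i,j)) such that: (i) G is spanned by a family of generators each of which is either a one-qubit vector X_c or Z_c, or a two-qubit vector X_c + X_{c'} or Z_c + Z_{c'} where the lattice positions of c and c' are equal or nearest neighbors (Chebyshev distance at most 1); (ii) dim C(G) − dim(G ∩ C(G)) = 2k, i.e. G has exactly k logical qubits; (iii) if k ≥ 1, every element of C(S) \ G, where S = G ∩ C(G), has weight at least β·m, i.e. the distance of G is at least β·m. -/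

import Mathlib

set_option linter.unusedSectionVars false

open Finset Matrix

abbrev F2 : Type := ZMod 2

abbrev PauliSpace (Q : Type) := Q → F2 × F2

section Pauli

variable {Q : Type} [Fintype Q] [DecidableEq Q]

/-- Support of a Pauli vector. -/
def psupp (v : PauliSpace Q) : Finset Q := Finset.univ.filter (fun q => v q ≠ (0, 0))

/-- Weight of a Pauli vector. -/
def pwt (v : PauliSpace Q) : ℕ := (psupp v).card

/-- The symplectic form. -/
def omegaF (u v : PauliSpace Q) : F2 :=
  ∑ q, ((u q).1 * (v q).2 + (u q).2 * (v q).1)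

lemma omegaF_add_left (u v w : PauliSpace Q) :
    omegaF (u + v) w = omegaF u w + omegaF v w := by
  simp only [omegaF, Pi.add_apply, Prod.fst_add, Prod.snd_add, ← Finset.sum_add_distrib]
  exact Finset.sum_congr rfl (fun q _ => by ring)

lemma omegaF_smul_left (c : F2) (u w : PauliSpace Q) :
    omegaF (c • u) w = c * omegaF u w := by
  simp only [omegaF, Pi.smul_apply, Prod.smul_fst, Prod.smul_snd, smul_eq_mul,
    Finset.mul_sum]
  exact Finset.sum_congr rfl (fun q _ => by ring)

/-- Centralizer of a subspace w.r.t. the symplectic form. -/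
def pcent (G : Submodule F2 (PauliSpace Q)) : Submodule F2 (PauliSpace Q) where
  carrier := {v | ∀ g ∈ G, omegaF v g = 0}
  zero_mem' := by
    intro g _
    simp [omegaF]
  add_mem' := by
    intro a b ha hb g hg
    rw [omegaF_add_left, ha g hg, hb g hg, add_zero]
  smul_mem' := by
    intro c a ha g hg
    rw [omegaF_smul_left, ha g hg, mul_zero]

/-- Stabilizer group of a gauge group. -/
def pstab (G : Submodule F2 (PauliSpace Q)) : Submodule F2 (PauliSpace Q) := G ⊓ pcent G

/-- Single-qubit Pauli X vector. -/
def Xop (c : Q) : PauliSpace Q := fun q => if q = c then (1, 0) else (0, 0)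

/-- Single-qubit Pauli Z vector. -/
def Zop (c : Q) : PauliSpace Q := fun q => if q = c then (0, 1) else (0, 0)

/-- The set of weights of dressed logical operators; its infimum is the distance. -/
def distSet (G : Submodule F2 (PauliSpace Q)) : Set ℕ :=
  {w | ∃ v, v ∈ pcent (pstab G) ∧ v ∉ G ∧ pwt v = w}

/-- Pauli vectors supported in `M`. -/
def PMod (M : Finset Q) : Submodule F2 (PauliSpace Q) where
  carrier := {v | ∀ q, q ∉ M → v q = 0}
  zero_mem' := by intro q _; rfl
  add_mem' := by
    intro a b ha hb q hq
    simp [Pi.add_apply, ha q hq, hb q hq]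
  smul_mem' := by
    intro c a ha q hq
    simp [Pi.smul_apply, ha q hq]

/-- Projection onto the qubits in `M`. -/
def projL (M : Finset Q) : PauliSpace Q →ₗ[F2] PauliSpace Q where
  toFun v := fun q => if q ∈ M then v q else 0
  map_add' a b := by funext q; by_cases h : q ∈ M <;> simp [h]
  map_smul' c a := by funext q; by_cases h : q ∈ M <;> simp [h]

/-- Number of independent dressed logical operators supported in `M`. -/
noncomputable def lM (G : Submodule F2 (PauliSpace Q)) (M : Finset Q) : ℕ :=
  Module.finrank F2 ↥(pcent ((pstab G).map (projL M)) ⊓ PMod M)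
    - Module.finrank F2 ↥(G ⊓ PMod M)

/-- Number of independent bare logical operators supported in `M`. -/
noncomputable def lbareM (G : Submodule F2 (PauliSpace Q)) (M : Finset Q) : ℕ :=
  Module.finrank F2 ↥(pcent (G.map (projL M)) ⊓ PMod M)
    - Module.finrank F2 ↥(pstab G ⊓ PMod M)

end Pauli

section Classical

variable {ι : Type} [Fintype ι] [DecidableEq ι]

/-- Hamming weight of a classical vector. -/
def hwt (v : ι → F2) : ℕ := (Finset.univ.filter (fun i => v i ≠ 0)).card

/-- Row space of a matrix. -/
def Crow (A : Matrix ι ι F2) : Submodule F2 (ι → F2) := Submodule.span F2 (Set.range A)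

/-- Column space of a matrix. -/
def Ccol (A : Matrix ι ι F2) : Submodule F2 (ι → F2) := Submodule.span F2 (Set.range Aᵀ)

/-- Minimum distance of the row space. -/
noncomputable def drow (A : Matrix ι ι F2) : ℕ := sInf {w | ∃ v ∈ Crow A, v ≠ 0 ∧ hwt v = w}

/-- Minimum distance of the column space. -/
noncomputable def dcol (A : Matrix ι ι F2) : ℕ := sInf {w | ∃ v ∈ Ccol A, v ≠ 0 ∧ hwt v = w}

/-- Number of nonzero entries of a matrix. -/
def nnz (A : Matrix ι ι F2) : ℕ :=
  (Finset.univ.filter (fun p : ι × ι => A p.1 p.2 ≠ 0)).card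

end Classical

section BaconShor

variable {m : ℕ}

/-- Qubit set of the generalized Bacon-Shor code: cells with `A i j = 1`. -/
abbrev QA (A : Matrix (Fin m) (Fin m) F2) : Type := {c : Fin m × Fin m // A c.1 c.2 = 1}

/-- Generators of the gauge group. -/
def gaugeSet (A : Matrix (Fin m) (Fin m) F2) : Set (PauliSpace (QA A)) :=
  {v | ∃ c c' : QA A, c ≠ c' ∧
    ((c.1.1 = c'.1.1 ∧ v = Xop c + Xop c') ∨ (c.1.2 = c'.1.2 ∧ v = Zop c + Zop c'))}

/-- Gauge group of the generalized Bacon-Shor code. -/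
def gaugeBS (A : Matrix (Fin m) (Fin m) F2) : Submodule F2 (PauliSpace (QA A)) :=
  Submodule.span F2 (gaugeSet A)

/-- The row operator `R i`. -/
def Rop (A : Matrix (Fin m) (Fin m) F2) (i : Fin m) : PauliSpace (QA A) :=
  ∑ c ∈ Finset.univ.filter (fun c : QA A => c.1.1 = i), Zop c

/-- The column operator `C j`. -/
def Cop (A : Matrix (Fin m) (Fin m) F2) (j : Fin m) : PauliSpace (QA A) :=
  ∑ c ∈ Finset.univ.filter (fun c : QA A => c.1.2 = j), Xop c

/-- X-type operator parameterized by a binary vector. -/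
def PXop (A : Matrix (Fin m) (Fin m) F2) (x : Fin m → F2) : PauliSpace (QA A) :=
  ∑ j, x j • Cop A j

/-- Z-type operator parameterized by a binary vector. -/
def PZop (A : Matrix (Fin m) (Fin m) F2) (z : Fin m → F2) : PauliSpace (QA A) :=
  ∑ i, z i • Rop A i

end BaconShor

/-- Binary entropy. -/
noncomputable def H2 (p : ℝ) : ℝ := -p * Real.logb 2 p - (1 - p) * Real.logb 2 (1 - p)
/-- Lattice position of a qubit: two qubits per site of the `m × m` lattice. -/
def posQ {m : ℕ} (c : Fin m × Fin m × Fin 2) : Fin m × Fin m := (c.1, c.2.1)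

/-- A generator is spatially local: a one-qubit `X_c`/`Z_c` vector, or a two-qubit
`X_c + X_{c'}`/`Z_c + Z_{c'}` vector whose qubits sit at lattice positions that are
equal or nearest neighbors (Chebyshev distance at most `1`). -/
def IsLocalGen {m : ℕ} (g : PauliSpace (Fin m × Fin m × Fin 2)) : Prop :=
  (∃ c, g = Xop c ∨ g = Zop c) ∨
  (∃ c c', c ≠ c' ∧
    Nat.dist ((posQ c).1 : ℕ) ((posQ c').1 : ℕ) ≤ 1 ∧
    Nat.dist ((posQ c).2 : ℕ) ((posQ c').2 : ℕ) ≤ 1 ∧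
    (g = Xop c + Xop c' ∨ g = Zop c + Zop c'))

/-- The Chernoff bound on the size of a Hamming ball: fewer than `2 ^ (n H₂(β))` of the binary
vectors of length `n` have weight below `β n`. -/
lemma card_hwt_lt_le (n : ℕ) (β : ℝ) (hβ0 : 0 < β) (hβ : β < 1 / 2) :
    ((Finset.univ.filter (fun v : Fin n → F2 => (hwt v : ℝ) < β * n)).card : ℝ)
      ≤ (2 : ℝ) ^ (H2 β * n) := by
  have hγ : 0 < 1 - β := by linarith
  have hpoint : ∀ w : ℕ, w ≤ n → (w : ℝ) < β * n →
      (2 : ℝ) ^ (-(H2 β * n)) ≤ β ^ w * (1 - β) ^ (n - w) := by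
    intro w hwn hw
    have hrw : β ^ w * (1 - β) ^ (n - w)
        = (2 : ℝ) ^ (Real.logb 2 β * w + Real.logb 2 (1 - β) * (n - w)) := by
      rw [Real.rpow_add two_pos, Real.rpow_mul two_pos.le, Real.rpow_mul two_pos.le,
        Real.rpow_logb two_pos (by norm_num) hβ0, Real.rpow_logb two_pos (by norm_num) hγ,
        Real.rpow_natCast, ← Nat.cast_sub hwn, Real.rpow_natCast]
    rw [hrw]
    refine Real.rpow_le_rpow_of_exponent_le one_le_two ?_
    have hlog : Real.logb 2 β ≤ Real.logb 2 (1 - β) :=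
      Real.logb_le_logb_of_le one_lt_two hβ0 (by linarith)
    unfold H2
    nlinarith [mul_nonneg (sub_nonneg.2 hlog) (sub_nonneg.2 hw.le)]
  have hinj : Function.Injective
      (fun v : Fin n → F2 => Finset.univ.filter (fun i => v i ≠ 0)) := by
    intro u v huv
    funext i
    have hi : u i ≠ 0 ↔ v i ≠ 0 := by simpa using congrArg (i ∈ ·) huv
    generalize u i = a at *
    generalize v i = b at *
    revert a b
    decide
  have hsum : ∑ v : Fin n → F2, β ^ hwt v * (1 - β) ^ (n - hwt v) ≤ 1 := by
    calc ∑ v : Fin n → F2, β ^ hwt v * (1 - β) ^ (n - hwt v)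
        = ∑ s ∈ Finset.univ.image
            (fun v : Fin n → F2 => Finset.univ.filter (fun i => v i ≠ 0)),
            β ^ s.card * (1 - β) ^ (n - s.card) := by
          rw [Finset.sum_image hinj.injOn]; rfl
      _ ≤ ∑ s : Finset (Fin n), β ^ s.card * (1 - β) ^ (n - s.card) :=
          Finset.sum_le_sum_of_subset_of_nonneg (Finset.subset_univ _)
            fun _ _ _ => by positivity
      _ = 1 := by rw [Fin.sum_pow_mul_eq_add_pow]; simp
  have hle : ∀ v : Fin n → F2, hwt v ≤ n := fun v =>
    (Finset.card_le_univ _).trans (Fintype.card_fin n).le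
  have hball : ((Finset.univ.filter (fun v : Fin n → F2 => (hwt v : ℝ) < β * n)).card : ℝ)
      * (2 : ℝ) ^ (-(H2 β * n)) ≤ 1 := by
    rw [← nsmul_eq_mul, ← Finset.sum_const]
    calc _ ≤ ∑ v ∈ Finset.univ.filter (fun v : Fin n → F2 => (hwt v : ℝ) < β * n),
            β ^ hwt v * (1 - β) ^ (n - hwt v) :=
          Finset.sum_le_sum fun v hv => hpoint _ (hle v) (by simpa using hv)
      _ ≤ ∑ v : Fin n → F2, β ^ hwt v * (1 - β) ^ (n - hwt v) :=
          Finset.sum_le_sum_of_subset_of_nonneg (Finset.filter_subset _ _)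
            fun _ _ _ => by positivity
      _ ≤ 1 := hsum
  rw [Real.rpow_neg two_pos.le] at hball
  exact (mul_inv_le_iff₀ (by positivity)).1 hball |>.trans (one_mul _).le

/-- The Gilbert-Varshamov bound for binary linear codes. -/
lemma exists_code (n : ℕ) (hn : 0 < n) (α β : ℝ) (hβ0 : 0 < β) (hβ : β < 1 / 2)
    (hαβ : α + H2 β < 1) (k : ℕ) (hk : (k : ℝ) ≤ α * n) :
    ∃ C : Submodule F2 (Fin n → F2), Module.finrank F2 C = k ∧
      ∀ v ∈ C, v ≠ 0 → β * n ≤ (hwt v : ℝ) := by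
  classical
  have hn' : (0 : ℝ) < n := by exact_mod_cast hn
  induction k with
  | zero => exact ⟨⊥, by simp, fun v hv h => absurd ((Submodule.mem_bot F2).1 hv) h⟩
  | succ k ih =>
    push_cast at hk
    obtain ⟨C, hC, hd⟩ := ih (by linarith)
    set L := Finset.univ.filter (fun v : Fin n → F2 => (hwt v : ℝ) < β * n) with hL
    set T := (Finset.univ.filter (fun v : Fin n → F2 => v ∈ C)) with hT
    have hTcard : T.card = 2 ^ k := by
      rw [← hC, hT, ← Fintype.card_subtype]
      have := Module.card_eq_pow_finrank (K := F2) (V := C)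
      rwa [ZMod.card] at this
    have hlt : (T ×ˢ L).card < Fintype.card (Fin n → F2) := by
      have hR : (2 : ℝ) ^ (k : ℝ) * (2 : ℝ) ^ (H2 β * n) < (2 : ℝ) ^ (n : ℝ) := by
        rw [← Real.rpow_add two_pos]
        refine Real.rpow_lt_rpow_of_exponent_lt one_lt_two ?_
        nlinarith
      have hb := card_hwt_lt_le n β hβ0 hβ
      rw [Finset.card_product, hTcard]
      have : ((2 ^ k * L.card : ℕ) : ℝ) < ((2 ^ n : ℕ) : ℝ) := by
        push_cast
        rw [← Real.rpow_natCast, ← Real.rpow_natCast]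
        exact (mul_le_mul_of_nonneg_left hb (by positivity)).trans_lt hR
      simpa using (by exact_mod_cast this : 2 ^ k * L.card < 2 ^ n)
    obtain ⟨x, hx⟩ : ∃ x, x ∉ (T ×ˢ L).image (fun p => p.1 + p.2) := by
      by_contra! h
      have := Finset.card_le_card (fun x _ => h x : Finset.univ ⊆ _)
      rw [Finset.card_univ] at this
      exact absurd (this.trans Finset.card_image_le) hlt.not_ge
    have hfar : ∀ c ∈ C, β * n ≤ (hwt (c + x) : ℝ) := by
      intro c hc
      by_contra! h
      refine hx (Finset.mem_image.2 ⟨(c, c + x), ?_, ?_⟩)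
      · simp [hT, hL, hc, h]
      · simp [← add_assoc, ZModModule.add_self]
    have hxC : x ∉ C := by
      intro h
      have := hfar x h
      rw [ZModModule.add_self] at this
      have h0 : hwt (0 : Fin n → F2) = 0 := by simp [hwt]
      rw [h0] at this
      push_cast at this
      nlinarith
    refine ⟨C ⊔ Submodule.span F2 {x}, by rw [Submodule.finrank_sup_span_singleton hxC, hC], ?_⟩
    intro v hv hv0
    obtain ⟨c, hc, y, hy, rfl⟩ := Submodule.mem_sup.1 hv
    obtain ⟨a, rfl⟩ := Submodule.mem_span_singleton.1 hy
    obtain rfl | rfl : a = 0 ∨ a = 1 :=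
      (by decide : ∀ a : F2, a = 0 ∨ a = 1) a
    · simp only [zero_smul, add_zero] at hv0 ⊢
      exact hd c hc hv0
    · simpa using hfar c hc

/-- A binary code of dimension `k` is the row space of a symmetric matrix of rank `k`. -/
lemma exists_symm_matrix_of_code {n k : ℕ} (C : Submodule F2 (Fin n → F2))
    (hC : Module.finrank F2 C = k) :
    ∃ A : Matrix (Fin n) (Fin n) F2, A.IsSymm ∧
      Module.finrank F2 (LinearMap.ker A.mulVecLin) + k = n ∧
      ∀ s : Fin n → F2, (∀ a, A *ᵥ a = 0 → s ⬝ᵥ a = 0) → s ∈ C := by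
  let b := Module.finBasisOfFinrankEq F2 C hC
  let B : Matrix (Fin k) (Fin n) F2 := fun i => (b i : Fin n → F2)
  have hli : LinearIndependent F2 B.row :=
    b.linearIndependent.map' C.subtype (Submodule.ker_subtype C)
  have hinj : Function.Injective B.vecMul := Matrix.vecMul_injective_iff.2 hli
  have hker : ∀ a, (Bᵀ * B) *ᵥ a = 0 ↔ B *ᵥ a = 0 := by
    intro a
    rw [← Matrix.mulVec_mulVec, Matrix.mulVec_transpose]
    exact ⟨fun h => hinj (by simpa using h), fun h => by simp [h]⟩
  refine ⟨Bᵀ * B, by simp [Matrix.IsSymm], ?_, ?_⟩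
  · have hk : LinearMap.ker (Bᵀ * B).mulVecLin = LinearMap.ker B.mulVecLin := by
      ext a
      simpa only [LinearMap.mem_ker, Matrix.mulVecLin_apply] using hker a
    have h1 := LinearMap.finrank_range_add_finrank_ker B.mulVecLin
    have h2 : Module.finrank F2 (LinearMap.range B.mulVecLin) = k :=
      hli.rank_matrix.trans (Fintype.card_fin k)
    rw [h2, Module.finrank_fin_fun] at h1
    rw [hk, add_comm, h1]
  · intro s hs
    have hmem : dotProductEquiv F2 (Fin n) s ∈ LinearMap.range B.mulVecLin.dualMap := by
      rw [LinearMap.range_dualMap_eq_dualAnnihilator_ker, Submodule.mem_dualAnnihilator]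
      intro a ha
      exact hs a ((hker a).2 (by simpa using ha))
    obtain ⟨φ, hφ⟩ := hmem
    obtain ⟨w, rfl⟩ := (dotProductEquiv F2 (Fin k)).surjective φ
    have hsw : s = w ᵥ* B := by
      refine dotProduct_eq _ _ fun a => ?_
      have := LinearMap.congr_fun hφ a
      simp only [LinearMap.dualMap_apply, dotProductEquiv_apply_apply,
        Matrix.mulVecLin_apply] at this
      rw [← this, Matrix.dotProduct_mulVec]
    rw [hsw, Matrix.vecMul_eq_sum]
    exact Submodule.sum_mem _ fun i _ => C.smul_mem _ (b i).2

section BlockCode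

variable {Q I J : Type} [Fintype Q] [DecidableEq Q] [Fintype I] [DecidableEq I]
  [Fintype J] [DecidableEq J]

/-- The parities of a binary vector on the disjoint blocks `{q | f q = some i}`. -/
def blockParity (f : Q → Option I) : (Q → F2) →ₗ[F2] (I → F2) where
  toFun x i := ∑ q, if f q = some i then x q else 0
  map_add' x y := by
    funext i
    simp only [Pi.add_apply, ← Finset.sum_add_distrib]
    exact Finset.sum_congr rfl fun q _ => by split_ifs <;> simp
  map_smul' c x := by
    funext i
    simp [Finset.mul_sum]

/-- The vector that is constant, with value `a i`, on each block `{q | f q = some i}`. -/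
def blockLift (f : Q → Option I) : (I → F2) →ₗ[F2] (Q → F2) where
  toFun a q := (f q).elim 0 a
  map_add' a b := by funext q; cases h : f q <;> simp [h]
  map_smul' c a := by funext q; cases h : f q <;> simp [h]

lemma blockParity_apply (f : Q → Option I) (x : Q → F2) (i : I) :
    blockParity f x i = ∑ q, if f q = some i then x q else 0 := rfl

lemma blockLift_apply (f : Q → Option I) (a : I → F2) (q : Q) :
    blockLift f a q = (f q).elim 0 a := rfl

lemma sum_blockParity_smul {V : Type} [AddCommGroup V] [Module F2 V] (f : Q → Option I)
    (x : Q → F2) (T : I → V) :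
    ∑ i, blockParity f x i • T i = ∑ q, x q • (f q).elim 0 T := by
  simp only [blockParity_apply, Finset.sum_smul]
  rw [Finset.sum_comm]
  refine Finset.sum_congr rfl fun q _ => ?_
  cases h : f q <;> simp [ite_smul]

lemma dotProduct_blockLift (f : Q → Option I) (x : Q → F2) (a : I → F2) :
    x ⬝ᵥ blockLift f a = blockParity f x ⬝ᵥ a :=
  (sum_blockParity_smul f x a).symm

lemma hwt_blockParity_le (f : Q → Option I) (x : Q → F2) : hwt (blockParity f x) ≤ hwt x := by
  unfold hwt
  rw [← Finset.card_map Function.Embedding.some]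
  refine (Finset.card_le_card ?_).trans (Finset.card_image_le (f := f))
  intro o ho
  obtain ⟨i, hi, rfl⟩ := Finset.mem_map.1 ho
  rw [Finset.mem_filter] at hi
  obtain ⟨q, -, hq⟩ := Finset.exists_ne_zero_of_sum_ne_zero hi.2
  obtain ⟨hf, hx⟩ : f q = some i ∧ x q ≠ 0 := by simpa using hq
  exact Finset.mem_image.2 ⟨q, by simpa using hx, hf⟩

lemma sum_smul_mem_of_blockParity_eq_zero {V : Type} [AddCommGroup V] [Module F2 V]
    (G : Submodule F2 V) (f : Q → Option I) (r : I → Q) (T : Q → V)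
    (hnone : ∀ q, f q = none → T q ∈ G) (hsome : ∀ q i, f q = some i → T q - T (r i) ∈ G)
    (x : Q → F2) (hx : blockParity f x = 0) : ∑ q, x q • T q ∈ G := by
  have h0 : ∑ q, x q • (f q).elim 0 (T ∘ r) = 0 := by simp [← sum_blockParity_smul, hx]
  rw [← sub_zero (∑ q, x q • T q), ← h0, ← Finset.sum_sub_distrib]
  refine Submodule.sum_mem _ fun q _ => ?_
  rw [← smul_sub]
  refine G.smul_mem _ ?_
  cases h : f q with
  | none => simpa using hnone q h
  | some i => simpa using hsome q i h

/-- The `X`-component of a Pauli vector. -/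
def xPart : PauliSpace Q →ₗ[F2] (Q → F2) := (LinearMap.fst F2 F2 F2).compLeft Q

/-- The `Z`-component of a Pauli vector. -/
def zPart : PauliSpace Q →ₗ[F2] (Q → F2) := (LinearMap.snd F2 F2 F2).compLeft Q

lemma xPart_apply (v : PauliSpace Q) (q : Q) : xPart v q = (v q).1 := rfl

lemma zPart_apply (v : PauliSpace Q) (q : Q) : zPart v q = (v q).2 := rfl

lemma omegaF_eq (u v : PauliSpace Q) :
    omegaF u v = xPart u ⬝ᵥ zPart v + zPart u ⬝ᵥ xPart v :=
  Finset.sum_add_distrib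

lemma sum_Xop_add_sum_Zop (v : PauliSpace Q) :
    ∑ q, xPart v q • Xop q + ∑ q, zPart v q • Zop q = v := by
  funext q
  rw [Pi.add_apply, Finset.sum_apply, Finset.sum_apply, Finset.sum_eq_single q,
    Finset.sum_eq_single q]
  · simp [Xop, Zop, xPart_apply, zPart_apply]
  all_goals simp +contextual [Xop, Zop, eq_comm, Prod.zero_eq_mk]

lemma xPart_Xop (c : Q) : xPart (Xop c) = Pi.single c 1 := by
  funext q; by_cases h : q = c <;> simp [xPart_apply, Xop, h]

lemma zPart_Xop (c : Q) : zPart (Xop c) = 0 := by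
  funext q; by_cases h : q = c <;> simp [zPart_apply, Xop, h]

lemma xPart_Zop (c : Q) : xPart (Zop c) = 0 := by
  funext q; by_cases h : q = c <;> simp [xPart_apply, Zop, h]

lemma zPart_Zop (c : Q) : zPart (Zop c) = Pi.single c 1 := by
  funext q; by_cases h : q = c <;> simp [zPart_apply, Zop, h]

lemma hwt_xPart_le (v : PauliSpace Q) : hwt (xPart v) ≤ pwt v := by
  refine Finset.card_le_card fun q hq => ?_
  rw [Finset.mem_filter] at hq
  exact Finset.mem_filter.2 ⟨hq.1, fun h => hq.2 (congrArg Prod.fst h)⟩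

lemma hwt_zPart_le (v : PauliSpace Q) : hwt (zPart v) ≤ pwt v := by
  refine Finset.card_le_card fun q hq => ?_
  rw [Finset.mem_filter] at hq
  exact Finset.mem_filter.2 ⟨hq.1, fun h => hq.2 (congrArg Prod.snd h)⟩

/-- The gauge group of all Pauli vectors whose `X`-part has even parity on the blocks of `p` and
whose `Z`-part has even parity on the blocks of `n`. -/
def blockGauge (p : Q → Option I) (n : Q → Option J) : Submodule F2 (PauliSpace Q) :=
  LinearMap.ker (blockParity p ∘ₗ xPart) ⊓ LinearMap.ker (blockParity n ∘ₗ zPart)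

/-- The bare logical operators of `blockGauge p n`. -/
def blockLogical (p : Q → Option I) (n : Q → Option J) :
    ((I → F2) × (J → F2)) →ₗ[F2] PauliSpace Q where
  toFun ab q := (blockLift n ab.2 q, blockLift p ab.1 q)
  map_add' a b := by funext q; simp
  map_smul' c a := by funext q; simp

lemma mem_blockGauge {p : Q → Option I} {n : Q → Option J} {v : PauliSpace Q} :
    v ∈ blockGauge p n ↔ blockParity p (xPart v) = 0 ∧ blockParity n (zPart v) = 0 := Iff.rfl

lemma xPart_blockLogical (p : Q → Option I) (n : Q → Option J) (ab : (I → F2) × (J → F2)) :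
    xPart (blockLogical p n ab) = blockLift n ab.2 := rfl

lemma zPart_blockLogical (p : Q → Option I) (n : Q → Option J) (ab : (I → F2) × (J → F2)) :
    zPart (blockLogical p n ab) = blockLift p ab.1 := rfl

lemma omegaF_blockLogical (p : Q → Option I) (n : Q → Option J) (v : PauliSpace Q)
    (ab : (I → F2) × (J → F2)) :
    omegaF v (blockLogical p n ab)
      = blockParity p (xPart v) ⬝ᵥ ab.1 + blockParity n (zPart v) ⬝ᵥ ab.2 := by
  rw [omegaF_eq, xPart_blockLogical, zPart_blockLogical, dotProduct_blockLift,
    dotProduct_blockLift]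

lemma omegaF_comm (u v : PauliSpace Q) : omegaF u v = omegaF v u := by
  rw [omegaF_eq, omegaF_eq, dotProduct_comm, dotProduct_comm (zPart u), add_comm]

lemma blockParity_single (f : Q → Option I) (q : Q) :
    blockParity f (Pi.single q 1) = (f q).elim 0 (fun i => Pi.single i 1) := by
  funext i
  rw [blockParity_apply, Finset.sum_eq_single q (fun b _ hb => by simp [hb]) (by simp)]
  cases h : f q with
  | none => simp
  | some j => simp [Pi.single_apply, eq_comm]

/-- A vector orthogonal to all vectors of even parity on the blocks is constant on blocks. -/
lemma exists_eq_blockLift (f : Q → Option I) (r : I → Q) (hr : ∀ i, f (r i) = some i)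
    (x : Q → F2) (hx : ∀ y, blockParity f y = 0 → x ⬝ᵥ y = 0) : ∃ a, x = blockLift f a := by
  refine ⟨fun i => x (r i), funext fun q => ?_⟩
  rw [blockLift_apply]
  cases h : f q with
  | none => simpa using hx (Pi.single q 1) (by simp [blockParity_single, h])
  | some i =>
    have := hx (Pi.single q 1 - Pi.single (r i) 1) (by simp [blockParity_single, h, hr])
    simpa [sub_eq_zero] using this

lemma pcent_blockGauge (p : Q → Option I) (n : Q → Option J) (rp : I → Q) (rn : J → Q)
    (hp : ∀ i, p (rp i) = some i) (hn : ∀ j, n (rn j) = some j) :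
    pcent (blockGauge p n) = LinearMap.range (blockLogical p n) := by
  ext v
  constructor
  · intro hv
    obtain ⟨a, ha⟩ := exists_eq_blockLift p rp hp (zPart v) fun y hy => by
      have h1 : xPart (fun q => (y q, 0) : PauliSpace Q) = y := rfl
      have h2 : zPart (fun q => (y q, 0) : PauliSpace Q) = 0 := rfl
      have := hv (fun q => (y q, 0)) (mem_blockGauge.2 ⟨by rw [h1, hy], by rw [h2, map_zero]⟩)
      rwa [omegaF_eq, h1, h2, dotProduct_zero, zero_add] at this
    obtain ⟨b, hb⟩ := exists_eq_blockLift n rn hn (xPart v) fun y hy => by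
      have h1 : xPart (fun q => (0, y q) : PauliSpace Q) = 0 := rfl
      have h2 : zPart (fun q => (0, y q) : PauliSpace Q) = y := rfl
      have := hv (fun q => (0, y q)) (mem_blockGauge.2 ⟨by rw [h1, map_zero], by rw [h2, hy]⟩)
      rwa [omegaF_eq, h1, h2, dotProduct_zero, add_zero] at this
    exact ⟨(a, b), funext fun q => Prod.ext (congrFun hb q).symm (congrFun ha q).symm⟩
  · rintro ⟨ab, rfl⟩ g hg
    rw [omegaF_comm, omegaF_blockLogical, (mem_blockGauge.1 hg).1, (mem_blockGauge.1 hg).2]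
    simp

lemma blockLift_injective (f : Q → Option I) (r : I → Q) (hr : ∀ i, f (r i) = some i) :
    Function.Injective (blockLift f) := by
  intro a b h
  funext i
  simpa [blockLift_apply, hr] using congrFun h (r i)

lemma blockLogical_injective (p : Q → Option I) (n : Q → Option J) (rp : I → Q) (rn : J → Q)
    (hp : ∀ i, p (rp i) = some i) (hn : ∀ j, n (rn j) = some j) :
    Function.Injective (blockLogical p n) := by
  intro a b h
  exact Prod.ext (blockLift_injective p rp hp (congrArg zPart h))
    (blockLift_injective n rn hn (congrArg xPart h))

lemma pstab_blockGauge (p : Q → Option I) (n : Q → Option J) (rp : I → Q) (rn : J → Q)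
    (hp : ∀ i, p (rp i) = some i) (hn : ∀ j, n (rn j) = some j) (A : Matrix I J F2)
    (hA : ∀ b, blockParity p (blockLift n b) = A *ᵥ b)
    (hA' : ∀ a, blockParity n (blockLift p a) = Aᵀ *ᵥ a) :
    pstab (blockGauge p n) = (LinearMap.range
      ((LinearMap.ker Aᵀ.mulVecLin).subtype.prodMap (LinearMap.ker A.mulVecLin).subtype)).map
        (blockLogical p n) := by
  rw [pstab, pcent_blockGauge p n rp rn hp hn, LinearMap.range_prodMap, Submodule.range_subtype,
    Submodule.range_subtype]
  ext v
  constructor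
  · rintro ⟨hG, ab, rfl⟩
    obtain ⟨h1, h2⟩ := mem_blockGauge.1 hG
    rw [xPart_blockLogical, hA] at h1
    rw [zPart_blockLogical, hA'] at h2
    exact ⟨ab, ⟨h2, h1⟩, rfl⟩
  · rintro ⟨ab, ⟨h1, h2⟩, rfl⟩
    refine ⟨mem_blockGauge.2 ⟨?_, ?_⟩, ab, rfl⟩
    · rw [xPart_blockLogical, hA]; exact h2
    · rw [zPart_blockLogical, hA']; exact h1

end BlockCode

lemma sub_mem_of_consecutive {V : Type} [AddCommGroup V] [Module F2 V] {m : ℕ} [NeZero m]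
    (G : Submodule F2 V) (T : Fin m → V)
    (h : ∀ j j' : Fin m, (j' : ℕ) = j + 1 → T j' - T j ∈ G) (j : Fin m) : T j - T 0 ∈ G := by
  obtain ⟨j, hj⟩ := j
  induction j with
  | zero => simp
  | succ j ih =>
    rw [← sub_add_sub_cancel _ (T ⟨j, by omega⟩)]
    exact G.add_mem (h _ _ rfl) (ih _)

section Lattice

variable {m : ℕ}

/-- The first qubits of the sites of a row form a block. -/
def rowBlock (c : Fin m × Fin m × Fin 2) : Option (Fin m) := if c.2.2 = 0 then some c.1 else none

/-- The qubit of site `(i, j)` in the block of column `j`: the first one if `A i j = 1`, and the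
second one otherwise. -/
def colQubit (A : Matrix (Fin m) (Fin m) F2) (i j : Fin m) : Fin m × Fin m × Fin 2 :=
  (i, j, if A i j = 1 then 0 else 1)

/-- One qubit in each site of a column forms a block. -/
def colBlock (A : Matrix (Fin m) (Fin m) F2) (c : Fin m × Fin m × Fin 2) : Option (Fin m) :=
  if c = colQubit A c.1 c.2.1 then some c.2.1 else none

lemma rowBlock_eq_some {c : Fin m × Fin m × Fin 2} {i : Fin m} :
    rowBlock c = some i ↔ c = (i, c.2.1, 0) := by
  obtain ⟨a, b, t⟩ := c
  simp only [rowBlock, Prod.mk.injEq]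
  split_ifs with h <;> simp_all

lemma colBlock_eq_some {A : Matrix (Fin m) (Fin m) F2} {c : Fin m × Fin m × Fin 2} {j : Fin m} :
    colBlock A c = some j ↔ c = colQubit A c.1 j := by
  obtain ⟨a, b, t⟩ := c
  simp only [colBlock, colQubit, Prod.mk.injEq]
  split_ifs <;> aesop

lemma blockParity_rowBlock (x : Fin m × Fin m × Fin 2 → F2) (i : Fin m) :
    blockParity rowBlock x i = ∑ j, x (i, j, 0) := by
  rw [blockParity_apply, Fintype.sum_prod_type, Finset.sum_eq_single i]
  · rw [Fintype.sum_prod_type]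
    simp [rowBlock]
  · intro b _ hb
    refine Finset.sum_eq_zero fun c _ => if_neg ?_
    simp [rowBlock, hb]
  · simp

lemma blockParity_colBlock (A : Matrix (Fin m) (Fin m) F2) (x : Fin m × Fin m × Fin 2 → F2)
    (j : Fin m) : blockParity (colBlock A) x j = ∑ i, x (colQubit A i j) := by
  rw [blockParity_apply, Fintype.sum_prod_type]
  refine Finset.sum_congr rfl fun i _ => ?_
  rw [Finset.sum_eq_single (colQubit A i j).2]
  · exact if_pos (colBlock_eq_some.2 rfl)
  · intro c _ hc
    exact if_neg fun h => hc (congrArg Prod.snd (colBlock_eq_some.1 h))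
  · simp

lemma blockLift_rowBlock_colQubit (A : Matrix (Fin m) (Fin m) F2) (a : Fin m → F2)
    (i j : Fin m) : blockLift rowBlock a (colQubit A i j) = A i j * a i := by
  rw [blockLift_apply, rowBlock, colQubit]
  obtain h | h : A i j = 0 ∨ A i j = 1 := (by decide : ∀ a : F2, a = 0 ∨ a = 1) _ <;> simp [h]

lemma blockLift_colBlock_first (A : Matrix (Fin m) (Fin m) F2) (b : Fin m → F2) (i j : Fin m) :
    blockLift (colBlock A) b (i, j, 0) = A i j * b j := by
  rw [blockLift_apply, colBlock, colQubit]
  obtain h | h : A i j = 0 ∨ A i j = 1 := (by decide : ∀ a : F2, a = 0 ∨ a = 1) _ <;> simp [h]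

lemma blockParity_rowBlock_blockLift (A : Matrix (Fin m) (Fin m) F2) (b : Fin m → F2) :
    blockParity rowBlock (blockLift (colBlock A) b) = A *ᵥ b := by
  funext i
  simp only [blockParity_rowBlock, blockLift_colBlock_first, Matrix.mulVec, dotProduct]

lemma blockParity_colBlock_blockLift (A : Matrix (Fin m) (Fin m) F2) (a : Fin m → F2) :
    blockParity (colBlock A) (blockLift rowBlock a) = Aᵀ *ᵥ a := by
  funext j
  simp only [blockParity_colBlock, blockLift_rowBlock_colQubit, Matrix.mulVec, dotProduct,
    Matrix.transpose_apply]

/-- The gauge group defined by the row and column blocks is generated by its local elements. -/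
lemma blockGauge_eq_span [NeZero m] (A : Matrix (Fin m) (Fin m) F2) :
    blockGauge rowBlock (colBlock A)
      = Submodule.span F2 {g | g ∈ blockGauge rowBlock (colBlock A) ∧ IsLocalGen g} := by
  refine le_antisymm (fun v hv => ?_) (Submodule.span_le.2 fun g hg => hg.1)
  obtain ⟨hx, hz⟩ := mem_blockGauge.1 hv
  rw [← sum_Xop_add_sum_Zop v]
  have hneg : ∀ u v : PauliSpace (Fin m × Fin m × Fin 2), u - v = u + v := fun u v =>
    ZModModule.sub_eq_add u v
  refine Submodule.add_mem _
    (sum_smul_mem_of_blockParity_eq_zero _ rowBlock (fun i => (i, 0, 0)) Xop ?_ ?_ _ hx)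
    (sum_smul_mem_of_blockParity_eq_zero _ (colBlock A) (colQubit A 0) Zop ?_ ?_ _ hz)
  · intro q hq
    refine Submodule.subset_span ⟨mem_blockGauge.2 ?_, Or.inl ⟨q, Or.inl rfl⟩⟩
    simp [xPart_Xop, zPart_Xop, blockParity_single, hq]
  · intro q i hq
    rw [rowBlock_eq_some.1 hq]
    refine sub_mem_of_consecutive _ (fun j => Xop (i, j, 0)) (fun j j' hj => ?_) q.2.1
    refine Submodule.subset_span ⟨mem_blockGauge.2 ?_, Or.inr
      ⟨(i, j', 0), (i, j, 0), ?_, ?_, ?_, Or.inl (hneg _ _)⟩⟩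
    · simp [xPart_Xop, zPart_Xop, blockParity_single, rowBlock]
    · intro h
      rw [Prod.mk.injEq, Prod.mk.injEq] at h
      rw [h.2.1] at hj
      omega
    · simp [posQ, Nat.dist]
    · simp only [posQ, Nat.dist]; omega
  · intro q hq
    refine Submodule.subset_span ⟨mem_blockGauge.2 ?_, Or.inl ⟨q, Or.inr rfl⟩⟩
    simp [xPart_Zop, zPart_Zop, blockParity_single, hq]
  · intro q j hq
    rw [colBlock_eq_some.1 hq]
    refine sub_mem_of_consecutive _ (fun i => Zop (colQubit A i j)) (fun i i' hi => ?_) q.1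
    refine Submodule.subset_span ⟨mem_blockGauge.2 ?_, Or.inr
      ⟨colQubit A i' j, colQubit A i j, ?_, ?_, ?_, Or.inr (hneg _ _)⟩⟩
    · have h : ∀ i, colBlock A (colQubit A i j) = some j := fun i => colBlock_eq_some.2 rfl
      simp [xPart_Zop, zPart_Zop, blockParity_single, h]
    · intro h
      rw [colQubit, colQubit, Prod.mk.injEq] at h
      rw [h.1] at hi
      omega
    · simp only [posQ, colQubit, Nat.dist]; omega
    · simp [posQ, colQubit, Nat.dist]

end Lattice

/-- There exists a family of 2D subsystem codes on `2m²` qubits, with spatially local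
one- and two-qubit gauge generators, having `k` logical qubits and distance at least `βm`,
for any `k ≤ αm`, whenever `α + H₂(β) < 1`. -/
theorem local_subsystem_codes_exist (α β : ℝ) (hα : 0 < α) (hβ0 : 0 < β) (hβ : β < 1 / 2)
    (hαβ : α + H2 β < 1) :
    ∃ m₀ : ℕ, ∀ m : ℕ, m₀ ≤ m → ∀ k : ℕ, (k : ℝ) ≤ α * m →
      ∃ G : Submodule F2 (PauliSpace (Fin m × Fin m × Fin 2)),
        (∃ gens : Set (PauliSpace (Fin m × Fin m × Fin 2)),
            G = Submodule.span F2 gens ∧ ∀ g ∈ gens, IsLocalGen g) ∧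
        Module.finrank F2 ↥(pcent G) = Module.finrank F2 ↥(pstab G) + 2 * k ∧
        (1 ≤ k → ∀ v, v ∈ pcent (pstab G) → v ∉ G → β * m ≤ (pwt v : ℝ)) := by
  refine ⟨1, fun m hm k hk => ?_⟩
  have : NeZero m := ⟨by omega⟩
  obtain ⟨C, hC, hd⟩ := exists_code m hm α β hβ0 hβ hαβ k hk
  obtain ⟨A, hsymm, hrank, hmem⟩ := exists_symm_matrix_of_code C hC
  have hp : ∀ i : Fin m, rowBlock (i, (0 : Fin m), 0) = some i := fun i =>
    rowBlock_eq_some.2 rfl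
  have hn : ∀ j, colBlock A (colQubit A 0 j) = some j := fun j => colBlock_eq_some.2 rfl
  have hinj := blockLogical_injective rowBlock (colBlock A) _ _ hp hn
  have hstab := pstab_blockGauge rowBlock (colBlock A) _ _ hp hn A
    (blockParity_rowBlock_blockLift A) (blockParity_colBlock_blockLift A)
  rw [hsymm.eq] at hstab
  refine ⟨blockGauge rowBlock (colBlock A), ⟨_, blockGauge_eq_span A, fun g hg => hg.2⟩, ?_, ?_⟩
  · rw [hstab, pcent_blockGauge _ _ _ _ hp hn, LinearMap.finrank_range_of_inj hinj,
      ← (Submodule.equivMapOfInjective _ hinj _).finrank_eq, LinearMap.finrank_range_of_inj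
        (Prod.map_injective.2 ⟨Subtype.val_injective, Subtype.val_injective⟩),
      Module.finrank_prod, Module.finrank_prod, Module.finrank_fin_fun]
    omega
  · intro _ v hv hvG
    have hker : ∀ a b, A *ᵥ a = 0 → A *ᵥ b = 0 → blockParity rowBlock (xPart v) ⬝ᵥ a
        + blockParity (colBlock A) (zPart v) ⬝ᵥ b = 0 := by
      intro a b ha hb
      rw [← omegaF_blockLogical rowBlock (colBlock A) v (a, b)]
      refine hv _ ?_
      rw [hstab]
      exact Submodule.mem_map_of_mem ⟨(⟨a, ha⟩, ⟨b, hb⟩), rfl⟩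
    by_cases hx : blockParity rowBlock (xPart v) = 0
    · have hz : blockParity (colBlock A) (zPart v) ≠ 0 := fun hz =>
        hvG (mem_blockGauge.2 ⟨hx, hz⟩)
      refine (hd _ (hmem _ fun b hb => ?_) hz).trans (Nat.cast_le.2
        ((hwt_blockParity_le _ _).trans (hwt_zPart_le v)))
      simpa using hker 0 b (Matrix.mulVec_zero A) hb
    · refine (hd _ (hmem _ fun a ha => ?_) hx).trans (Nat.cast_le.2
        ((hwt_blockParity_le _ _).trans (hwt_xPart_le v)))
      simpa using hker a 0 ha (Matrix.mulVec_zero A)
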